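/- arXiv:0810.2578 — 2 statements merged into one kernel-verified Lean document; each statement's English description precedes it below -/
import Mathlib

section
/- Let K be a cocomplete category and F : K → L a functor. Then F preserves sifted colimits if and only if F preserves reflexive coequalizers and filtered colimits. -/
open CategoryTheory Limits

universe v u₁ u₂

section Sifted

open WalkingReflexivePair WalkingReflexivePair.Hom

/-- The category indexing reflexive pairs is sifted. -/
instance WalkingReflexivePair.isSifted : IsSifted WalkingReflexivePair where
  nonempty := ⟨zero⟩
  out := by
    rintro ⟨c₁, c₂⟩
    let A (e : WalkingReflexivePair) (x : c₁ ⟶ e) (y : c₂ ⟶ e) :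
        StructuredArrow (c₁, c₂) (Functor.diag WalkingReflexivePair) :=
      StructuredArrow.mk (Y := e) (x, y)
    have hA {e e'} {x : c₁ ⟶ e} {y : c₂ ⟶ e} {x' : c₁ ⟶ e'} {y' : c₂ ⟶ e'} (h : e ⟶ e')
        (hx : x ≫ h = x') (hy : y ≫ h = y') : Zigzag (A e x y) (A e' x' y') :=
      .of_hom (StructuredArrow.homMk h (Prod.ext hx hy))
    have toZero (j : StructuredArrow (c₁, c₂) (Functor.diag WalkingReflexivePair)) :
        ∃ (x : c₁ ⟶ zero) (y : c₂ ⟶ zero), Zigzag j (A zero x y) := by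
      obtain ⟨⟨⟨⟩⟩, e, x, y⟩ := j
      cases e with
      | zero => exact ⟨x, y, .refl _⟩
      | one => exact ⟨x ≫ left, y ≫ left, hA left rfl rfl⟩
    let b (c : WalkingReflexivePair) : c ⟶ zero := match c with
      | zero => Hom.id zero
      | one => left
    have conn (x : Hom c₁ zero) (y : Hom c₂ zero) :
        Zigzag (A zero x y) (A zero (b c₁) (b c₂)) := by
      cases c₁ <;> cases c₂ <;> cases x <;> cases y
      · exact .refl _
      · exact .refl _
      · exact (hA (x := reflexion) (y := Hom.id one) right rfl rfl).symm.trans (hA left rfl rfl)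
      · exact .refl _
      · exact (hA (x := Hom.id one) (y := reflexion) right rfl rfl).symm.trans (hA left rfl rfl)
      · exact .refl _
      · exact (hA (x := Hom.id one) (y := rightCompReflexion) left rfl rfl).symm.trans
          ((hA right rfl rfl).trans
            ((hA (x := Hom.id one) (y := Hom.id one) right rfl rfl).symm.trans
              (hA left rfl rfl)))
      · exact (hA (x := rightCompReflexion) (y := Hom.id one) left rfl rfl).symm.trans
          ((hA right rfl rfl).trans
            ((hA (x := Hom.id one) (y := Hom.id one) right rfl rfl).symm.trans
              (hA left rfl rfl)))
      · exact (hA (x := Hom.id one) (y := Hom.id one) right rfl rfl).symm.trans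
          (hA left rfl rfl)
    have : Nonempty (StructuredArrow (c₁, c₂) (Functor.diag WalkingReflexivePair)) :=
      ⟨A zero (b c₁) (b c₂)⟩
    refine zigzag_isConnected fun j j' => ?_
    obtain ⟨x, y, h⟩ := toZero j
    obtain ⟨x', y', h'⟩ := toZero j'
    exact h.trans ((conn x y).trans ((conn x' y').symm.trans h'.symm))

variable {D : Type u₁} [Category.{v} D] [IsSifted D]

/-- For a sifted category, all finite diagonal functors are final. -/
theorem CategoryTheory.IsSifted.final_pi'_id (I : Type u₂) [Finite I] :
    (Functor.pi' fun _ : I => 𝟭 D).Final := by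
  induction I using Finite.induction_empty_option with
  | of_equiv e ih =>
    let E := Pi.equivalenceOfEquiv (fun _ => D) e.symm
    have := Functor.final_comp (Functor.pi' fun _ => 𝟭 D) E.inverse
    exact Functor.final_of_natIso (F := (Functor.pi' fun _ => 𝟭 D) ⋙ E.inverse)
      (NatIso.pi' fun _ => Iso.refl (𝟭 D))
  | h_empty =>
    constructor
    intro d
    let F : D ⥤ StructuredArrow d (Functor.pi' fun _ : PEmpty => 𝟭 D) :=
      { obj e := StructuredArrow.mk (Y := e) (fun i => i.elim)
        map h := StructuredArrow.homMk h (by ext i; exact i.elim) }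
    have hF (j) : Zigzag j (F.obj j.right) :=
      .of_hom (StructuredArrow.homMk (𝟙 _) (by ext i; exact i.elim))
    have : Nonempty D := IsSifted.nonempty
    have : Nonempty (StructuredArrow d (Functor.pi' fun _ : PEmpty => 𝟭 D)) :=
      ⟨F.obj (Classical.arbitrary D)⟩
    exact zigzag_isConnected fun j j' => (hF j).trans
      ((zigzag_obj_of_zigzag F (isPreconnected_zigzag j.right j'.right)).trans (hF j').symm)
  | @h_option I _ ih =>
    let E := Pi.optionEquivalence (fun _ : Option I => D)
    have := Functor.final_comp ((𝟭 D).prod' (Functor.pi' fun _ : I => 𝟭 D)) E.inverse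
    refine Functor.final_of_natIso (F := (𝟭 D).prod' (Functor.pi' fun _ : I => 𝟭 D) ⋙ E.inverse)
      (NatIso.pi' fun i => ?_)
    exact match i with
    | none => Iso.refl (𝟭 D)
    | some _ => Iso.refl (𝟭 D)

theorem CategoryTheory.IsSifted.exists_hom_family {I : Type u₂} [Finite I] (d : I → D) :
    ∃ e : D, Nonempty (∀ i, d i ⟶ e) := by
  have := IsSifted.final_pi'_id (D := D) I
  have j : StructuredArrow d (Functor.pi' fun _ : I => 𝟭 D) := Classical.arbitrary _
  exact ⟨j.right, ⟨j.hom⟩⟩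

/-- An assignment on the cocones over a finite family of objects of a sifted category is constant
if it is invariant under morphisms of cocones. -/
theorem CategoryTheory.IsSifted.eq_of_invariant {I : Type u₂} [Finite I] {d : I → D} {T : Type*}
    (φ : ∀ e : D, (∀ i, d i ⟶ e) → T)
    (hφ : ∀ (e e' : D) (a : ∀ i, d i ⟶ e) (h : e ⟶ e'), φ e' (fun i => a i ≫ h) = φ e a)
    {e e' : D} (a : ∀ i, d i ⟶ e) (a' : ∀ i, d i ⟶ e') : φ e a = φ e' a' := by
  have := IsSifted.final_pi'_id (D := D) I
  refine constant_of_preserves_morphisms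
    (J := StructuredArrow d (Functor.pi' fun _ : I => 𝟭 D))
    (fun j => φ j.right j.hom) (fun j j' f => ?_) (StructuredArrow.mk a) (StructuredArrow.mk a')
  rw [← StructuredArrow.w f]
  exact (hφ _ _ _ f.right).symm

end Sifted

section Coproducts

variable {K : Type u₁} {L : Type u₂} [Category.{v} K] [Category.{v} L] [HasColimits K] (F : K ⥤ L)

/-- The image of a coproduct under a functor preserving filtered colimits is the colimit of the
images of its finite subcoproducts. -/
noncomputable def isColimitMapFiniteSubcoproductsCocone {α : Type v} (X : α → K)
    [PreservesColimitsOfShape (Finset (Discrete α)) F] :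
    IsColimit (F.mapCocone (CoproductsFromFiniteFiltered.finiteSubcoproductsCocone X)) :=
  isColimitOfPreserves F (CoproductsFromFiniteFiltered.isColimitFiniteSubproductsCocone X)

theorem map_sigma_hom_ext {α : Type v} (X : α → K)
    [PreservesColimitsOfShape (Finset (Discrete α)) F] {l : L} {p q : F.obj (∐ X) ⟶ l}
    (h : ∀ (I : Type v) [Finite I] (u : I → α),
      F.map (Sigma.desc fun i => Sigma.ι X (u i)) ≫ p =
        F.map (Sigma.desc fun i => Sigma.ι X (u i)) ≫ q) : p = q :=
  (isColimitMapFiniteSubcoproductsCocone F X).hom_ext fun S => h S fun i => i.1.as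

variable {F} {D : Type v} [Category.{v} D] [IsSifted D] {G : D ⥤ K} (t : Cocone (G ⋙ F))

theorem map_desc_comp_ι_eq {I : Type v} [Finite I] {d : I → D} {e e' : D}
    (a : ∀ i, d i ⟶ e) (a' : ∀ i, d i ⟶ e') :
    F.map (Sigma.desc fun i => G.map (a i)) ≫ t.ι.app e =
      F.map (Sigma.desc fun i => G.map (a' i)) ≫ t.ι.app e' := by
  refine IsSifted.eq_of_invariant
    (fun e a => F.map (Sigma.desc fun i => G.map (a i)) ≫ t.ι.app e) (fun e e' a h => ?_) a a'
  dsimp only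
  rw [← t.w h, Functor.comp_map, ← F.map_comp_assoc]
  congr 2
  ext i
  simp

theorem map_desc_ι_comp_map_desc_comp_ι_eq {I J : Type v} [Finite I] [Finite J] {d : J → D}
    (σ : I → J) {e e' : D} (a : ∀ j, d j ⟶ e) (a' : ∀ i, d (σ i) ⟶ e') :
    F.map (Sigma.desc fun i => Sigma.ι (fun j => G.obj (d j)) (σ i)) ≫
        F.map (Sigma.desc fun j => G.map (a j)) ≫ t.ι.app e =
      F.map (Sigma.desc fun i => G.map (a' i)) ≫ t.ι.app e' := by
  rw [← map_desc_comp_ι_eq t (fun i => a (σ i)) a', ← F.map_comp_assoc]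
  congr 2
  ext i
  simp

/-- A cocone on the image of a sifted diagram induces a morphism from the image of the coproduct of
the objects of the diagram. -/
theorem exists_map_sigma_hom [PreservesColimitsOfShape (Finset (Discrete D)) F] :
    ∃ Φ : F.obj (∐ G.obj) ⟶ t.pt,
      ∀ (I : Type v) [Finite I] (u : I → D) (e : D) (a : ∀ i, u i ⟶ e),
        F.map (Sigma.desc fun i => Sigma.ι G.obj (u i)) ≫ Φ =
          F.map (Sigma.desc fun i => G.map (a i)) ≫ t.ι.app e := by
  classical
  choose e a using fun S : Finset (Discrete D) =>
    IsSifted.exists_hom_family (fun i : S => i.1.as)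
  replace a := fun S => (a S).some
  let s : Cocone (CoproductsFromFiniteFiltered.liftToFinsetObj (Discrete.functor G.obj) ⋙ F) :=
    { pt := t.pt
      ι :=
        { app S := F.map (Sigma.desc fun i => G.map (a S i)) ≫ t.ι.app (e S)
          naturality S S' h := by
            dsimp
            rw [Category.comp_id]
            exact map_desc_ι_comp_map_desc_comp_ι_eq t (d := fun i : S' => i.1.as)
              (fun i : S => ⟨i.1, h.down.down i.2⟩) (a S') (a S) } }
  refine ⟨(isColimitMapFiniteSubcoproductsCocone F G.obj).desc s, fun I _ u e' a' => ?_⟩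
  have := Fintype.ofFinite I
  let S : Finset (Discrete D) := Finset.univ.image fun i => ⟨u i⟩
  have hS (i : I) : ⟨u i⟩ ∈ S := Finset.mem_image_of_mem _ (Finset.mem_univ i)
  have fac := (isColimitMapFiniteSubcoproductsCocone F G.obj).fac s S
  have hu : (Sigma.desc fun i => Sigma.ι G.obj (u i)) =
      (Sigma.desc fun i => Sigma.ι (fun x : S => G.obj x.1.as) ⟨⟨u i⟩, hS i⟩) ≫
        Sigma.desc fun x : S => Sigma.ι G.obj x.1.as := by
    ext i
    simp
  rw [hu, F.map_comp]
  refine (Category.assoc _ _ _).trans ((congrArg _ fac).trans ?_)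
  exact map_desc_ι_comp_map_desc_comp_ι_eq t (d := fun x : S => x.1.as)
    (fun i => ⟨⟨u i⟩, hS i⟩) (a S) a'

end Coproducts

section Main

variable {K : Type u₁} {L : Type u₂} [Category.{v} K] [Category.{v} L] [HasColimits K] {F : K ⥤ L}

theorem preservesColimit_of_isSifted
    (h₁ : ∀ ⦃X Y : K⦄ (f g : X ⟶ Y), IsReflexivePair f g →
      Nonempty (PreservesColimit (parallelPair f g) F))
    (h₂ : ∀ D : Cat.{v, v}, IsFiltered D → Nonempty (PreservesColimitsOfShape D F))
    {D : Type v} [Category.{v} D] [IsSifted D] (G : D ⥤ K) : PreservesColimit G F := by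
  classical
  have hF (α : Type v) : PreservesColimitsOfShape (Finset (Discrete α)) F :=
    (h₂ (Cat.of (Finset (Discrete α))) (inferInstanceAs (IsFiltered (Finset _)))).some
  let X : Arrow D → K := fun f => G.obj f.left
  let l : ∐ X ⟶ ∐ G.obj := Sigma.desc fun f => Sigma.ι G.obj f.left
  let r : ∐ X ⟶ ∐ G.obj := Sigma.desc fun f => G.map f.hom ≫ Sigma.ι G.obj f.right
  have hlr : IsReflexivePair l r :=
    .mk' (Sigma.desc fun d => Sigma.ι X (Arrow.mk (𝟙 d)))
      (by ext d; simp [l, X]) (by ext d; simp [r, X])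
  have := (h₁ l r hlr).some
  let π : ∐ G.obj ⟶ colimit G := Sigma.desc (colimit.ι G)
  have w : l ≫ π = r ≫ π := by ext f; simp [l, r, π]
  have hπ : IsColimit (Cofork.ofπ π w) := by
    refine Cofork.IsColimit.mk' _ fun s => ?_
    refine ⟨colimit.desc G ⟨s.pt, { app d := Sigma.ι G.obj d ≫ s.π, naturality d d' f := ?_ }⟩,
      ?_, ?_⟩
    · simpa [l, r, X] using (Sigma.ι X (Arrow.mk f) ≫= s.condition).symm
    · apply Sigma.hom_ext
      intro d
      simp [π]
    · intro m hm
      refine colimit.hom_ext (F := G) fun d => ?_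
      simp [← hm, π]
  have hFπ := isColimitCoforkMapOfIsColimit F w hπ
  refine preservesColimit_of_preserves_colimit_cocone (colimit.isColimit G) ?_
  choose Φ hΦ using fun t : Cocone (G ⋙ F) => exists_map_sigma_hom t
  have hΦ_ι (t : Cocone (G ⋙ F)) (d : D) : F.map (Sigma.ι G.obj d) ≫ Φ t = t.ι.app d := by
    have := F.map (Sigma.ι (fun _ : PUnit.{v + 1} => G.obj d) ⟨⟩) ≫=
      hΦ t PUnit (fun _ => d) d (fun _ => 𝟙 d)
    simpa [← F.map_comp_assoc] using this
  have hΦ_w (t : Cocone (G ⋙ F)) : F.map l ≫ Φ t = F.map r ≫ Φ t := by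
    refine map_sigma_hom_ext F X fun I _ u => ?_
    obtain ⟨e, ⟨a⟩⟩ := IsSifted.exists_hom_family
      (Sum.elim (fun i => (u i).left) (fun i => (u i).right))
    have hl : (Sigma.desc fun i => Sigma.ι X (u i)) ≫ l =
        Sigma.desc fun i => Sigma.ι G.obj (u i).left := by
      ext i; simp [l, X]
    have hr : (Sigma.desc fun i => Sigma.ι X (u i)) ≫ r =
        Limits.Sigma.map (fun i => G.map (u i).hom) ≫
          Sigma.desc fun i => Sigma.ι G.obj (u i).right := by
      ext i; simp [r, X]
    rw [← F.map_comp_assoc, ← F.map_comp_assoc, hl, hr, F.map_comp, Category.assoc,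
      hΦ t I (fun i => (u i).left) e (fun i => a (.inl i)),
      hΦ t I (fun i => (u i).right) e (fun i => a (.inr i)), ← F.map_comp_assoc]
    refine (map_desc_comp_ι_eq t _ (fun i => (u i).hom ≫ a (.inr i))).trans ?_
    congr 2
    ext i
    simp
    exact G.map_comp _ _
  exact
    { desc t := Cofork.IsColimit.desc hFπ (Φ t) (hΦ_w t)
      fac t d := by
        have : F.map π ≫ Cofork.IsColimit.desc hFπ (Φ t) (hΦ_w t) = Φ t :=
          Cofork.IsColimit.π_desc' hFπ _ _
        refine Eq.trans ?_ ((F.map (Sigma.ι G.obj d) ≫= this).trans (hΦ_ι t d))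
        rw [← F.map_comp_assoc]
        simp [π]
      uniq t m hm := by
        refine Cofork.IsColimit.hom_ext hFπ ?_
        rw [Cofork.IsColimit.π_desc' hFπ]
        change F.map π ≫ m = Φ t
        refine map_sigma_hom_ext F G.obj fun I _ u => ?_
        obtain ⟨e, ⟨a⟩⟩ := IsSifted.exists_hom_family u
        have hu : (Sigma.desc fun i => Sigma.ι G.obj (u i)) ≫ π =
            (Sigma.desc fun i => G.map (a i)) ≫ colimit.ι G e := by
          ext i; simp [π]
        rw [hΦ t I u e a, ← F.map_comp_assoc, hu, F.map_comp, Category.assoc, ← hm e]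
        rfl }

omit [HasColimits K] in
theorem preservesColimit_parallelPair_of_isReflexivePair
    [PreservesColimitsOfShape WalkingReflexivePair F] {X Y : K} (f g : X ⟶ Y)
    [IsReflexivePair f g] : PreservesColimit (parallelPair f g) F :=
  preservesColimit_of_iso_diagram F (inclusionWalkingReflexivePairOfIsReflexivePairIso f g)

end Main

/-- For a cocomplete category `K` and a functor `F : K ⥤ L`, `F` preserves sifted colimits
if and only if it preserves reflexive coequalizers and filtered colimits. -/
theorem stmt3 {K : Type u₁} {L : Type u₂} [Category.{v} K] [Category.{v} L]
    [HasColimits K] (F : K ⥤ L) :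
    (∀ D : Cat.{v, v}, IsSifted D → Nonempty (PreservesColimitsOfShape D F)) ↔
      ((∀ ⦃X Y : K⦄ (f g : X ⟶ Y), IsReflexivePair f g →
          Nonempty (PreservesColimit (parallelPair f g) F)) ∧
        (∀ D : Cat.{v, v}, IsFiltered D → Nonempty (PreservesColimitsOfShape D F))) := by
  refine ⟨fun h => ⟨fun X Y f g _ => ⟨?_⟩, fun D _ => h D IsFiltered.isSifted⟩,
    fun ⟨h₁, h₂⟩ D _ => ⟨⟨fun {G} => preservesColimit_of_isSifted h₁ h₂ G⟩⟩⟩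
  have : PreservesColimitsOfShape (AsSmall.{v} WalkingReflexivePair) F :=
    (h (Cat.of (AsSmall.{v} WalkingReflexivePair))
      (IsSifted.isSifted_iff_asSmallIsSifted.mp inferInstance)).some
  have : PreservesColimitsOfShape WalkingReflexivePair F :=
    preservesColimitsOfShape_of_equiv AsSmall.equiv.symm F
  exact preservesColimit_parallelPair_of_isReflexivePair f g
end

section
/- Let A be a small category with finite products and F : [A^op, Set] → Set be the left Kan extension along Yoneda of a finite-product-preserving functor M : A → Set (i.e., F = Lan_Y M where A^op has finite coproducts—equivalently M : A → Set preserves finite products when A has finite products in the relevant variance). Then F preserves finite products. -/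
open CategoryTheory Limits

universe u

section

lemma isLeftKanExtension_of_iso_left {C D H : Type*} [Category* C] [Category* D] [Category* H]
    {L L' : C ⥤ D} (e : L ≅ L') {F : C ⥤ H} {F' : D ⥤ H} (α : F ⟶ L ⋙ F')
    [F'.IsLeftKanExtension α] : F'.IsLeftKanExtension (α ≫ Functor.whiskerRight e.hom F') :=
  ⟨⟨IsInitial.isInitialObj (Functor.leftExtensionEquivalenceOfIso₁ e F).functor _
    (F'.isUniversalOfIsLeftKanExtension α)⟩⟩

variable {A : Type u} [SmallCategory A]

lemma isSifted_elements_op [HasFiniteProducts A] (M : A ⥤ Type u) [PreservesFiniteProducts M] :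
    IsSifted M.Elementsᵒᵖ := by
  have : HasTerminal M.Elements :=
    inferInstanceAs (HasLimitsOfShape (Discrete PEmpty.{1}) M.Elements)
  have : HasBinaryProducts M.Elements :=
    inferInstanceAs (HasLimitsOfShape (Discrete WalkingPair) M.Elements)
  have : Nonempty M.Elementsᵒᵖ := ⟨.op (⊤_ _)⟩
  infer_instance

/-- The functor `M ⋆ (−)`, computed as a colimit over the category of elements of `M`. -/
noncomputable abbrev elementsColim (M : A ⥤ Type u) : (Aᵒᵖ ⥤ Type u) ⥤ Type u :=
  (Functor.whiskeringLeft _ _ _).obj (CategoryOfElements.π M).op ⋙ colim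

/-- `M ⋆ (−)` extends `M` along the Yoneda embedding. -/
noncomputable def uliftYonedaCompElementsColimIso (M : A ⥤ Type u) :
    M ≅ uliftYoneda.{u} ⋙ elementsColim M :=
  (Functor.Elements.shrinkYonedaCompWhiskeringLeftObjπCompColimIso M).symm ≪≫
    Functor.isoWhiskerRight (shrinkYonedaIsoYoneda ≪≫ uliftYonedaIsoYoneda.{u}.symm) _

lemma preservesColimits_elementsColim (M : A ⥤ Type u) :
    PreservesColimitsOfSize.{u, u} (elementsColim M) :=
  have : PreservesColimitsOfSize.{u, u} (colim : (M.Elementsᵒᵖ ⥤ Type u) ⥤ Type u) :=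
    colimConstAdj.leftAdjoint_preservesColimits
  inferInstance

/-- The left Kan extension of `M` along the Yoneda embedding is `M ⋆ (−)`. -/
noncomputable def elementsColimIsoLeftKanExtension (M : A ⥤ Type u) :
    elementsColim M ≅ yoneda.leftKanExtension M :=
  have := preservesColimits_elementsColim M
  have := Presheaf.isLeftKanExtension_of_preservesColimits.{u, u, u, u, u + 1} (elementsColim M)
    (uliftYonedaCompElementsColimIso M)
  have := isLeftKanExtension_of_iso_left uliftYonedaIsoYoneda.{u}
    (uliftYonedaCompElementsColimIso M).hom
  Functor.leftKanExtensionUnique _ ((uliftYonedaCompElementsColimIso M).hom ≫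
    Functor.whiskerRight uliftYonedaIsoYoneda.{u}.hom _) _ (yoneda.leftKanExtensionUnit M)

end

/-- If `A` is a small category with finite products and `M : A ⥤ Type` preserves finite
products, then the left Kan extension of `M` along the Yoneda embedding, i.e. the functor
`M ⋆ (−) : [Aᵒᵖ, Type] ⥤ Type`, preserves finite products. -/
theorem stmt18 {A : Type u} [SmallCategory A] [HasFiniteProducts A]
    (M : A ⥤ Type u) [PreservesFiniteProducts M] :
    Nonempty (PreservesFiniteProducts (yoneda.leftKanExtension M)) := by
  have := isSifted_elements_op M
  exact ⟨⟨fun n ↦ preservesLimitsOfShape_of_natIso (elementsColimIsoLeftKanExtension M)⟩⟩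
end
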